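/- arXiv:2504.17329 — 6 statements merged into one kernel-verified Lean document; each statement's English description precedes it below -/
import Mathlib

section
/- There exists an explicit 15-stage Runge–Kutta method of order 10; that is, there exist a strictly lower triangular real 15×15 matrix A = [a_{ij}] (a_{ij} = 0 whenever j ≥ i), a real row vector b of 15 weights, and a real vector c of 15 nodes with Σ_{j=1}^{15} a_{ij} = c_i for every i, such that for every rooted tree t with |t| ≤ 10 one has bΦ(t) = 1/t!. -/
/-- Rooted trees: `node ts` is the tree obtained by connecting the roots of the
trees in `ts` by new edges to a new root vertex; `node []` is the one-vertex tree `•`. -/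
inductive RTree where
  | node : List RTree → RTree

namespace RTree

/-- The order `|t|` of a rooted tree: its number of vertices. -/
def order : RTree → ℕ
  | node ts => 1 + (ts.attach.map fun x => order x.1).sum
decreasing_by
  simp only [RTree.node.sizeOf_spec]; have := List.sizeOf_lt_of_mem x.2; omega

/-- The tree factorial: `•! = 1` and `[t₁…tₙ]! = |[t₁…tₙ]| ⬝ ∏ₘ tₘ!`. -/
def factorial : RTree → ℕ
  | node ts => (node ts).order * (ts.attach.map fun x => factorial x.1).prod
decreasing_by
  simp only [RTree.node.sizeOf_spec]; have := List.sizeOf_lt_of_mem x.2; omega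

end RTree

/-- Derivative weights: `Φ(•) = 𝟙` and `Φ([t₁…tₙ]) = ∏ₘ (A·Φ(tₘ))`, element-wise. -/
def Phi {s : ℕ} (A : Matrix (Fin s) (Fin s) ℝ) : RTree → Fin s → ℝ
  | .node ts => fun i => (ts.attach.map fun x => A.mulVec (Phi A x.1) i).prod
decreasing_by
  simp only [RTree.node.sizeOf_spec]; have := List.sizeOf_lt_of_mem x.2; omega

namespace RungeKutta

/-! ### Exact arithmetic on forests

A forest `ts` is encoded by the product of the factorials of its trees and by the elementwise
product of the vectors `A *ᵥ Φ(t)`, `t ∈ ts`, cleared of denominators. The functions that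
compute these codes are written in continuation-passing style, so that kernel reduction
evaluates every number to a literal before passing it on. -/

/-- The code of a forest. -/
structure ForestCode where
  fac : ℕ
  vec : List (ℤ√2701)

/-- Applies `k` to `n` after evaluating `n`. -/
def forceNat {α : Type} (n : ℕ) (k : ℕ → α) : α :=
  match n with
  | 0 => k 0
  | n + 1 => k (Nat.succ n)

/-- Applies `k` to `x` after evaluating `x`. -/
def forceInt {α : Type} (x : ℤ) (k : ℤ → α) : α :=
  match x with
  | .ofNat n => forceNat n fun n => k (.ofNat n)
  | .negSucc n => forceNat n fun n => k (.negSucc n)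

/-- Applies `k` to `x` after evaluating both coordinates. -/
def forceZsqrtd {α : Type} (x : ℤ√2701) (k : ℤ√2701 → α) : α :=
  forceInt x.re fun a => forceInt x.im fun b => k ⟨a, b⟩

/-- Applies `k` to `l` after evaluating all entries. -/
def forceList {α : Type} (l : List (ℤ√2701)) (k : List (ℤ√2701) → α) : α :=
  match l with
  | [] => k []
  | x :: l => forceZsqrtd x fun x => forceList l fun l => k (x :: l)

theorem forceNat_eq {α : Type} (n : ℕ) (k : ℕ → α) : forceNat n k = k n := by
  cases n <;> rfl

theorem forceInt_eq {α : Type} (x : ℤ) (k : ℤ → α) : forceInt x k = k x := by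
  cases x <;> simp [forceInt, forceNat_eq]

theorem forceZsqrtd_eq {α : Type} (x : ℤ√2701) (k : ℤ√2701 → α) : forceZsqrtd x k = k x := by
  simp [forceZsqrtd, forceInt_eq]

theorem forceList_eq {α : Type} (l : List (ℤ√2701)) (k : List (ℤ√2701) → α) :
    forceList l k = k l := by
  induction l generalizing k with
  | nil => rfl
  | cons x l ih => simp [forceList, forceZsqrtd_eq, ih]

/-- The dot product; the shorter list is padded with zeros. -/
def dot (r v : List (ℤ√2701)) : ℤ√2701 :=
  match r, v with
  | x :: r, y :: v => x * y + dot r v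
  | _, _ => 0

/-- The sum of two lists; the shorter one is padded with zeros. -/
def addPadded (p q : List (ℤ√2701)) : List (ℤ√2701) :=
  match p, q with
  | x :: p, y :: q => (x + y) :: addPadded p q
  | [], q => q
  | p, [] => p

/-- The row vector `w * M`. -/
def vecMul (w : List (ℤ√2701)) (M : List (List (ℤ√2701))) : List (ℤ√2701) :=
  match w, M with
  | x :: w, r :: M => addPadded (r.map (x * ·)) (vecMul w M)
  | _, _ => []

theorem dot_nil_right (r : List (ℤ√2701)) : dot r [] = 0 := by cases r <;> rfl

theorem dot_addPadded (p q v : List (ℤ√2701)) : dot (addPadded p q) v = dot p v + dot q v := by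
  induction p generalizing q v with
  | nil => simp [addPadded, dot]
  | cons x p ih =>
    cases q with
    | nil => simp [addPadded, dot]
    | cons y q =>
      cases v with
      | nil => simp [dot_nil_right]
      | cons z v => simp only [addPadded, dot, ih]; ring

theorem dot_map_mul (x : ℤ√2701) (r v : List (ℤ√2701)) : dot (r.map (x * ·)) v = x * dot r v := by
  induction r generalizing v with
  | nil => simp [dot]
  | cons y r ih =>
    cases v with
    | nil => simp [dot_nil_right]
    | cons z v => simp only [List.map_cons, dot, ih]; ring

theorem dot_vecMul (w : List (ℤ√2701)) (M : List (List (ℤ√2701))) (v : List (ℤ√2701)) :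
    dot (vecMul w M) v = dot w (M.map (dot · v)) := by
  induction w generalizing M with
  | nil => simp [vecMul, dot]
  | cons x w ih =>
    cases M with
    | nil => simp [vecMul, dot]
    | cons r M => simp only [vecMul, List.map_cons, dot, dot_addPadded, dot_map_mul, ih]

/-- The code of the union of two forests. -/
def ForestCode.mul (e g : ForestCode) : ForestCode :=
  ⟨e.fac * g.fac, List.zipWith (· * ·) e.vec g.vec⟩

/-- Adds `e.mul g` for all `g ∈ l` to `acc`. -/
def mulInto {α : Type} (e : ForestCode) (l acc : List ForestCode)
    (k : List ForestCode → α) : α :=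
  match l with
  | [] => k acc
  | g :: l => forceList (List.zipWith (· * ·) e.vec g.vec) fun v =>
      forceNat (e.fac * g.fac) fun f => mulInto e l (⟨f, v⟩ :: acc) k

/-- `T` lists codes of forests by total order. The codes of all forests obtained by adding
copies of a tree of order `n` with code `e` are inserted; `acc` holds the finished part in
reverse. -/
def addTree {α : Type} (n : ℕ) (e : ForestCode) (acc T : List (List ForestCode))
    (k : List (List ForestCode) → α) : α :=
  match T with
  | [] => k acc.reverse
  | f :: T => mulInto e (acc.getD (n - 1) []) f fun f => addTree n e (f :: acc) T k

/-- The code of the tree of order `n` whose branches form the forest `g`. -/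
def ForestCode.graft (M : List (List (ℤ√2701))) (n : ℕ) (g : ForestCode) : ForestCode :=
  ⟨g.fac * n, M.map (dot · g.vec)⟩

/-- Inserts all trees of order `n` with branches in `F` into the table `T`. -/
def addTrees {α : Type} (M : List (List (ℤ√2701))) (n : ℕ) (F : List ForestCode)
    (T : List (List ForestCode)) (k : List (List ForestCode) → α) : α :=
  match F with
  | [] => k T
  | g :: F => forceList (M.map (dot · g.vec)) fun v => forceNat (g.fac * n) fun f =>
      addTree n ⟨f, v⟩ [] T fun T => addTrees M n F T k

/-- `N` is the common denominator of `w * Φ(t)`, and `γ` the quotient of `t!` by the factorials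
in `g`. -/
def checkCode (w : List (ℤ√2701)) (N γ : ℕ) (g : ForestCode) : Bool :=
  decide (dot w g.vec * ((g.fac * γ : ℕ) : ℤ√2701) = (N : ℤ√2701))

/-- Checks the order conditions for all trees whose order lies between `n` and `n + fuel + 1`,
given a table `T` of all forests of trees of order less than `n`. -/
def checkFrom (M : List (List (ℤ√2701))) (w : List (ℤ√2701)) (D E : ℕ) (fuel n : ℕ)
    (T : List (List ForestCode)) : Bool :=
  (T.getD (n - 1) []).all (checkCode w (E * D ^ (n - 1)) n) &&
  match fuel with
  | 0 => (T.getD n []).all (checkCode w (E * D ^ n) (n + 1)) &&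
      forceList (vecMul w M) fun w =>
        (T.getD (n - 1) []).all (checkCode w (E * D ^ n) (n * (n + 1)))
  | fuel + 1 => addTrees M n (T.getD (n - 1) []) T (checkFrom M w D E fuel (n + 1))

/-! ### Soundness of the computation -/

/-- The number of vertices of a forest. -/
def forestOrder (ts : List RTree) : ℕ := (ts.map RTree.order).sum

/-- The product of the factorials of the trees of a forest. -/
def forestFactorial (ts : List RTree) : ℕ := (ts.map RTree.factorial).prod

theorem order_node (ts : List RTree) : (RTree.node ts).order = forestOrder ts + 1 := by
  rw [RTree.order, List.attach_map_val (f := RTree.order), forestOrder, add_comm]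

theorem factorial_node (ts : List RTree) :
    (RTree.node ts).factorial = (forestOrder ts + 1) * forestFactorial ts := by
  rw [RTree.factorial, List.attach_map_val (f := RTree.factorial), forestFactorial, order_node]

theorem Phi_node {s : ℕ} (A : Matrix (Fin s) (Fin s) ℝ) (ts : List RTree) (i : Fin s) :
    Phi A (.node ts) i = (ts.map fun t => A.mulVec (Phi A t) i).prod := by
  rw [Phi]
  exact congrArg List.prod (List.attach_map_val (f := fun t => A.mulVec (Phi A t) i))

theorem order_pos (t : RTree) : 0 < t.order := by
  cases t; simp [order_node]

theorem order_le_forestOrder {ts : List RTree} {t : RTree} (h : t ∈ ts) :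
    t.order ≤ forestOrder ts :=
  List.le_sum_of_mem (List.mem_map_of_mem h)

theorem eq_singleton_of_forestOrder_le {ts : List RTree} {t : RTree} (h : t ∈ ts)
    (hle : forestOrder ts ≤ t.order) : ts = [t] := by
  obtain ⟨us, vs, rfl⟩ := List.append_of_mem h
  have h1 (u : RTree) (hu : u ∈ us ++ vs) : False := by
    have h2 := order_le_forestOrder hu
    have h3 := order_pos u
    simp only [forestOrder, List.map_append, List.map_cons, List.sum_append, List.sum_cons]
      at hle h2
    omega
  have h4 := List.eq_nil_iff_forall_not_mem.2 h1
  simp_all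

/-- The embedding of `ℤ√2701` into the reals. -/
noncomputable def embed : ℤ√2701 →+* ℝ := Zsqrtd.toReal (by norm_num)

theorem dot_eq_sum (r v : List (ℤ√2701)) :
    dot r v = ∑ i ∈ Finset.range v.length, r.getD i 0 * v.getD i 0 := by
  induction v generalizing r with
  | nil => simp [dot_nil_right]
  | cons y v ih =>
    cases r with
    | nil => simp [dot]
    | cons x r => rw [dot, ih, List.length_cons, Finset.sum_range_succ']; simp [add_comm]

theorem embed_dot {s : ℕ} (r : List (ℤ√2701)) {v : List (ℤ√2701)} (hv : v.length = s) :
    embed (dot r v) = ∑ i : Fin s, embed (r.getD i 0) * embed (v.getD i 0) := by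
  rw [dot_eq_sum, hv, map_sum, Finset.sum_range]
  simp only [map_mul]

section Soundness

variable {s : ℕ} {A : Matrix (Fin s) (Fin s) ℝ} {D : ℕ}

/-- `g` is the code of the forest `ts` for the method with coefficients `A`, whose common
denominator is `D`. -/
def Represents (A : Matrix (Fin s) (Fin s) ℝ) (D : ℕ) (g : ForestCode) (ts : List RTree) : Prop :=
  g.fac = forestFactorial ts ∧ g.vec.length = s ∧
    ∀ i : Fin s, embed (g.vec.getD i 0) = (D : ℝ) ^ forestOrder ts * Phi A (.node ts) i

theorem Represents.perm {g : ForestCode} {ts us : List RTree} (h : ts.Perm us)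
    (hg : Represents A D g ts) : Represents A D g us := by
  obtain ⟨h1, h2, h3⟩ := hg
  refine ⟨h1.trans (h.map _).prod_eq, h2, fun i => ?_⟩
  rw [h3, Phi_node, Phi_node, (h.map _).prod_eq, forestOrder, (h.map _).sum_eq, forestOrder]

theorem Represents.mul {e g : ForestCode} {t : RTree} {ts : List RTree}
    (he : Represents A D e [t]) (hg : Represents A D g ts) :
    Represents A D (e.mul g) (t :: ts) := by
  obtain ⟨h1, h2, h3⟩ := he
  obtain ⟨h4, h5, h6⟩ := hg
  refine ⟨by simp [ForestCode.mul, h1, h4, forestFactorial], by simp [ForestCode.mul, h2, h5],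
    fun i => ?_⟩
  have h7 : (e.mul g).vec.getD i 0 = e.vec.getD i 0 * g.vec.getD i 0 := by
    simp [ForestCode.mul, h2, h5]
  rw [h7, map_mul, h3, h6]
  simp only [Phi_node, forestOrder, List.map_cons, List.map_nil, List.sum_cons, List.sum_nil,
    List.prod_cons, List.prod_nil, pow_add, add_zero, mul_one]
  ring

theorem Represents.graft {M : List (List (ℤ√2701))} (hM : M.length = s)
    (hA : ∀ i j : Fin s, embed ((M.getD i []).getD j 0) = D * A i j)
    {g : ForestCode} {ts : List RTree} (hg : Represents A D g ts) :
    Represents A D (g.graft M (forestOrder ts + 1)) [.node ts] := by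
  obtain ⟨h1, h2, h3⟩ := hg
  refine ⟨by simp [ForestCode.graft, h1, forestFactorial, factorial_node, mul_comm],
    by simp [ForestCode.graft, hM], fun i => ?_⟩
  have h4 : (g.graft M (forestOrder ts + 1)).vec.getD i 0 = dot (M.getD i []) g.vec := by
    simp [ForestCode.graft, hM]
  rw [h4, embed_dot _ h2, Phi_node]
  simp only [hA, h3, forestOrder, List.map_cons, List.map_nil, List.sum_cons, List.sum_nil,
    List.prod_cons, List.prod_nil, order_node, Matrix.mulVec, dotProduct, add_zero, mul_one]
  rw [Finset.mul_sum]
  refine Finset.sum_congr rfl fun j _ => ?_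
  ring

theorem mulInto_eq {α : Type} (e : ForestCode) (l acc : List ForestCode)
    (k : List ForestCode → α) :
    mulInto e l acc k = k ((l.map e.mul).reverse ++ acc) := by
  induction l generalizing acc with
  | nil => rfl
  | cons g l ih => simp [mulInto, forceList_eq, forceNat_eq, ih, ForestCode.mul]

theorem exists_addTree_eq {n : ℕ} (hn : 1 ≤ n) (e : ForestCode) (acc T : List (List ForestCode)) :
    ∃ U : List (List ForestCode), (∀ k : _ → Bool, addTree n e acc T k = k (acc.reverse ++ U)) ∧
      U.length = T.length ∧ ∀ j < T.length, T.getD j [] ⊆ U.getD j [] ∧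
        (n ≤ acc.length + j → ∀ g ∈ (acc.reverse ++ U).getD (acc.length + j - n) [],
          e.mul g ∈ U.getD j []) := by
  induction T generalizing acc with
  | nil => exact ⟨[], by simp [addTree]⟩
  | cons f T ih =>
    obtain ⟨U, h1, h2, h3⟩ := ih ((((acc.getD (n - 1) []).map e.mul).reverse ++ f) :: acc)
    refine ⟨(((acc.getD (n - 1) []).map e.mul).reverse ++ f) :: U, fun k => ?_, by simp [h2], ?_⟩
    · rw [addTree, mulInto_eq, h1]
      simp
    · rintro (_ | j) hj
      · refine ⟨by simp, fun hle g hg => ?_⟩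
        have h4 : acc.length - n < acc.reverse.length := by simp; omega
        rw [add_zero, List.getD_append _ _ _ _ h4] at hg
        have h5 : acc.reverse.getD (acc.length - n) [] = acc.getD (n - 1) [] := by
          have h6 : n - 1 < acc.length := by omega
          rw [List.getD_eq_getElem _ _ h4, List.getD_eq_getElem _ _ h6, List.getElem_reverse]
          congr 1
          omega
        rw [h5] at hg
        simp only [List.getD_cons_zero, List.mem_append, List.mem_reverse]
        exact Or.inl (List.mem_map_of_mem hg)
      · obtain ⟨h4, h5⟩ := h3 j (by simpa using hj)
        refine ⟨by simpa using h4, fun hle g hg => ?_⟩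
        rw [List.getD_cons_succ]
        refine h5 (by simp; omega) g ?_
        simpa [add_assoc, add_comm 1 j] using hg

/-- The table `T` contains codes of all forests that consist of trees in `S`. -/
def Covers (A : Matrix (Fin s) (Fin s) ℝ) (D : ℕ) (S : RTree → Prop)
    (T : List (List ForestCode)) : Prop :=
  ∀ ts : List RTree, (∀ t ∈ ts, S t) → forestOrder ts < T.length →
    ∃ g ∈ T.getD (forestOrder ts) [], Represents A D g ts

theorem Covers.addTree {S : RTree → Prop} {T : List (List ForestCode)} (hT : Covers A D S T)
    {n : ℕ} (hn : 1 ≤ n) (e : ForestCode) :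
    ∃ U : List (List ForestCode), (∀ k : _ → Bool, addTree n e [] T k = k U) ∧
      U.length = T.length ∧
        Covers A D (fun t => S t ∨ t.order = n ∧ Represents A D e [t]) U := by
  obtain ⟨U, h1, h2, h3⟩ := exists_addTree_eq hn e [] T
  refine ⟨U, by simpa using h1, h2, fun ts => ?_⟩
  induction hl : ts.length generalizing ts with
  | zero =>
    intro _ hlt
    rw [List.length_eq_zero_iff] at hl
    subst hl
    obtain ⟨g, hg, hr⟩ := hT [] (by simp) (h2 ▸ hlt)
    exact ⟨g, (h3 _ (h2 ▸ hlt)).1 hg, hr⟩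
  | succ l ih =>
    intro hts hlt
    by_cases hS : ∀ t ∈ ts, S t
    · obtain ⟨g, hg, hr⟩ := hT ts hS (h2 ▸ hlt)
      exact ⟨g, (h3 _ (h2 ▸ hlt)).1 hg, hr⟩
    · push Not at hS
      obtain ⟨t, ht, hnS⟩ := hS
      obtain ⟨hto, hte⟩ := (hts t ht).resolve_left hnS
      obtain ⟨us, vs, rfl⟩ := List.append_of_mem ht
      have hord : forestOrder (us ++ t :: vs) = forestOrder (us ++ vs) + n := by
        simp [forestOrder, hto]; omega
      obtain ⟨g, hg, hr⟩ := ih (us ++ vs) (by simp at hl ⊢; omega)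
        (fun u hu => hts u (by simp at hu ⊢; tauto)) (by omega)
      refine ⟨e.mul g, (h3 _ (h2 ▸ hlt)).2 (by simp; omega) g ?_,
        (hte.mul hr).perm List.perm_middle.symm⟩
      simpa [hord] using hg

theorem Covers.addTrees {M : List (List (ℤ√2701))} (hM : M.length = s)
    (hA : ∀ i j : Fin s, embed ((M.getD i []).getD j 0) = D * A i j)
    {S : RTree → Prop} {T : List (List ForestCode)} (hT : Covers A D S T)
    {n : ℕ} (hn : 1 ≤ n) (F : List ForestCode) :
    ∃ U : List (List ForestCode), (∀ k : _ → Bool, addTrees M n F T k = k U) ∧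
      U.length = T.length ∧
        Covers A D (fun t => S t ∨ ∃ ts, t = .node ts ∧ forestOrder ts + 1 = n ∧
          ∃ g ∈ F, Represents A D g ts) U := by
  induction F generalizing S T with
  | nil => exact ⟨T, by simp [RungeKutta.addTrees], rfl, by simpa using hT⟩
  | cons g F ih =>
    obtain ⟨U, h1, h2, h3⟩ := hT.addTree hn (g.graft M n)
    obtain ⟨V, h4, h5, h6⟩ := ih h3
    refine ⟨V, fun k => ?_, h5.trans h2, fun ts hts => h6 ts fun t ht => ?_⟩
    · rw [RungeKutta.addTrees, forceList_eq, forceNat_eq]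
      exact (h1 _).trans (h4 k)
    · obtain h | ⟨us, rfl, ho, g', hg', hr⟩ := hts t ht
      · exact Or.inl (Or.inl h)
      · obtain rfl | hg' := List.mem_cons.1 hg'
        · refine Or.inl (Or.inr ⟨by rw [order_node, ho], ?_⟩)
          subst ho
          exact hr.graft hM hA
        · exact Or.inr ⟨us, rfl, ho, g', hg', hr⟩

/-- The order condition of a tree follows from the check of the code of its branches. -/
theorem sum_eq_of_checkCode {w : List (ℤ√2701)} {b : Fin s → ℝ} {E : ℕ}
    (hb : ∀ i : Fin s, embed (w.getD i 0) = E * b i) (hD : D ≠ 0) (hE : E ≠ 0)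
    {g : ForestCode} {ts : List RTree} (hg : Represents A D g ts)
    (h : checkCode w (E * D ^ forestOrder ts) (forestOrder ts + 1) g = true) :
    ∑ i, b i * Phi A (.node ts) i = 1 / ((RTree.node ts).factorial : ℝ) := by
  obtain ⟨h1, h2, h3⟩ := hg
  have h4 := congrArg embed (of_decide_eq_true h)
  have hN : ((E : ℝ) * (D : ℝ) ^ forestOrder ts) ≠ 0 := by positivity
  have h5 : embed (dot w g.vec) =
      (E : ℝ) * (D : ℝ) ^ forestOrder ts * ∑ i, b i * Phi A (.node ts) i := by
    rw [embed_dot _ h2, Finset.mul_sum]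
    refine Finset.sum_congr rfl fun i _ => ?_
    rw [hb, h3]
    ring
  have h6 : g.fac * (forestOrder ts + 1) = (RTree.node ts).factorial := by
    rw [factorial_node, h1, mul_comm]
  rw [map_mul, map_natCast, map_natCast, h5, h6, Nat.cast_mul, Nat.cast_pow, mul_assoc] at h4
  exact eq_one_div_of_mul_eq_one_left (mul_left_cancel₀ hN (h4.trans (mul_one _).symm))

theorem sum_eq_of_all_checkCode {w : List (ℤ√2701)} {b : Fin s → ℝ} {E : ℕ}
    (hb : ∀ i : Fin s, embed (w.getD i 0) = E * b i) (hD : D ≠ 0) (hE : E ≠ 0)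
    {n : ℕ} {T : List (List ForestCode)} (hc : Covers A D (fun t => t.order < n) T)
    (hT : n ≤ T.length) {ts : List RTree} (ho : forestOrder ts + 1 = n)
    (h : (T.getD (n - 1) []).all (checkCode w (E * D ^ (n - 1)) n) = true) :
    ∑ i, b i * Phi A (.node ts) i = 1 / ((RTree.node ts).factorial : ℝ) := by
  subst ho
  obtain ⟨g, hg, hr⟩ := hc ts (fun u hu => Nat.lt_succ_of_le (order_le_forestOrder hu)) hT
  exact sum_eq_of_checkCode hb hD hE hr (List.all_eq_true.1 h g hg)

theorem checkCode_graft {M : List (List (ℤ√2701))} {w : List (ℤ√2701)} {N n γ : ℕ}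
    {g : ForestCode} (h : checkCode (vecMul w M) N (n * γ) g = true) :
    checkCode w N γ (g.graft M n) = true := by
  rw [checkCode, dot_vecMul, ← mul_assoc] at h
  exact h

/-- If `checkFrom` succeeds on a table of the forests of trees of order less than `n`, then the
order conditions hold for all trees whose order lies between `n` and `n + fuel + 1`. -/
theorem sum_eq_of_checkFrom {M : List (List (ℤ√2701))} (hM : M.length = s)
    (hA : ∀ i j : Fin s, embed ((M.getD i []).getD j 0) = D * A i j)
    {w : List (ℤ√2701)} {b : Fin s → ℝ} {E : ℕ}
    (hb : ∀ i : Fin s, embed (w.getD i 0) = E * b i) (hD : D ≠ 0) (hE : E ≠ 0)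
    {fuel n : ℕ} (hn : 1 ≤ n) {T : List (List ForestCode)}
    (hT : n + fuel < T.length)
    (hc : Covers A D (fun t => t.order < n) T) (h : checkFrom M w D E fuel n T = true)
    (t : RTree) (ht : n ≤ t.order) (ht' : t.order ≤ n + fuel + 1) :
    ∑ i, b i * Phi A t i = 1 / (t.factorial : ℝ) := by
  obtain ⟨ts⟩ := t
  rw [order_node] at ht ht'
  induction fuel generalizing n T with
  | zero =>
    simp only [checkFrom, forceList_eq, Bool.and_eq_true] at h
    obtain ⟨h1, h2, h3⟩ := h
    obtain ho | rfl : forestOrder ts + 1 = n ∨ forestOrder ts = n := by omega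
    · exact sum_eq_of_all_checkCode hb hD hE hc (by omega) ho h1
    · by_cases hlt : ∀ u ∈ ts, u.order < forestOrder ts
      · obtain ⟨g, hg, hr⟩ := hc ts hlt hT
        exact sum_eq_of_checkCode hb hD hE hr (List.all_eq_true.1 h2 g hg)
      · push Not at hlt
        obtain ⟨u, hu, hle⟩ := hlt
        obtain rfl := eq_singleton_of_forestOrder_le hu hle
        obtain ⟨us⟩ := u
        have ho : forestOrder [.node us] = forestOrder us + 1 := by
          simp [forestOrder, order_node]
        obtain ⟨g, hg, hr⟩ := hc us
          (fun v hv => by have := order_le_forestOrder hv; omega) (by omega)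
        have h4 := List.all_eq_true.1 h3 g (by rwa [ho, Nat.add_sub_cancel])
        refine sum_eq_of_checkCode hb hD hE (hr.graft hM hA) ?_
        rw [← ho]
        exact checkCode_graft h4
  | succ fuel ih =>
    rw [checkFrom, Bool.and_eq_true] at h
    obtain ho | ho : forestOrder ts + 1 = n ∨ n < forestOrder ts + 1 := by omega
    · exact sum_eq_of_all_checkCode hb hD hE hc (by omega) ho h.1
    · obtain ⟨U, h1, h2, h3⟩ := hc.addTrees hM hA hn (T.getD (n - 1) [])
      refine ih (n := n + 1) (T := U) (by omega) (by omega) ?_ ((h1 _).symm.trans h.2) (by omega)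
        (by omega)
      intro us hus
      refine h3 us fun t ht => ?_
      obtain hlt | heq := Nat.lt_succ_iff_lt_or_eq.1 (hus t ht)
      · exact Or.inl hlt
      · obtain ⟨vs⟩ := t
        rw [order_node] at heq
        obtain ⟨g, hg, hr⟩ := hc vs
          (fun v hv => by have := order_le_forestOrder hv; omega) (by omega)
        exact Or.inr ⟨vs, rfl, heq, g, by rwa [← heq], hr⟩

/-- The initial table contains only the empty forest. -/
theorem covers_nil (A : Matrix (Fin s) (Fin s) ℝ) (D m : ℕ) :
    Covers A D (fun t => t.order < 1) ([⟨1, List.replicate s 1⟩] :: List.replicate m []) := by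
  intro ts hts _
  obtain rfl : ts = [] := by
    refine List.eq_nil_iff_forall_not_mem.2 fun t ht => ?_
    have h1 := hts t ht
    have h2 := order_pos t
    omega
  refine ⟨⟨1, List.replicate s 1⟩, by simp [forestOrder], by simp [forestFactorial], by simp,
    fun i => ?_⟩
  simp [forestOrder, Phi_node]

end Soundness

/-! ### The method -/

/-- The common denominator of the coefficients. -/
def rkDenominator : ℕ := 11556042911045141522709751627199734884056169851623285021202300930701673027925315608464051980584197260778741241680001519759692432695957590593538089431885000000

/-- The rows of the coefficient matrix below the diagonal, multiplied by `rkDenominator`. -/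
def rkMatrix : List (List (ℤ√2701)) := [
  [],
  [⟨2407508939801071150564531588999944767511702052421517712750479360562848547484440751763344162621707762662237758683333649949935923478324498040320435298309375000, 0⟩],
  [⟨1011153754716449883237103267379976802354914862017037439355201331436396389943465115740604548301117260318139858647000132978973087860896289176934582825289937500, 0⟩,
    ⟨433351609164192807101615686019990058152106369435873188295086284901312738547199335317401949271907397279202796563000056990988466226098409647257678353695687500, 0⟩],
  [⟨-1155604291104514152270975162719973488405616985162328502120230093070167302792531560846405198058419726077874124168000151975969243269595759059353808943188500000, 0⟩,
    ⟨-1733406436656771228406462744079960232608425477743492753180345139605250954188797341269607797087629589116811186252000227963953864904393638589030713414782750000, 0⟩,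
    ⟨5778021455522570761354875813599867442028084925811642510601150465350836513962657804232025990292098630389370620840000759879846216347978795296769044715942500000, 0⟩],
  [⟨481501787960214230112906317799988953502340410484303542550095872112569709496888150352668832524341552532447551736666729989987184695664899608064087059661875000, 0⟩,
    ⟨0, 0⟩,
    ⟨1926007151840856920451625271199955814009361641937214170200383488450278837987552601410675330097366210129790206946666919959948738782659598432256348238647500000, 0⟩,
    ⟨481501787960214230112906317799988953502340410484303542550095872112569709496888150352668832524341552532447551736666729989987184695664899608064087059661875000, 0⟩],
  [⟨784141183355783722894433992444645933604908827609005714287344059495257557084644186692302384050614939871771925132744501843776112031129449677220417225282000000, 0⟩,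
    ⟨304356685722999612120750660140239931102713938478967177513147020397081100323958929605637583027731944316806353690337488586263504400222751357196064906848000000, 0⟩,
    ⟨1183609333367220713802919233878710843177220871862650134773349523766426501259840281799701711774513116787580264351312455613246961556421810833540252415520000000, 0⟩,
    ⟨493170555569675297417883014116129517990508696609437556155562301569344375524933450749875713239380465328158443479713523172186233981842421180641771839800000000, 0⟩,
    ⟨-197268222227870118967153205646451807196203478643775022462224920627737750209973380299950285295752186131263377391885409268874493592736968472256708735920000000, 0⟩],
  [⟨480841291680433414982435938763226280040745979194201617251673244030110766136810114481128820408395953694954482392720685092881578132296360651125727543805000000, 0⟩,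
    ⟨0, 0⟩,
    ⟨1932423401415870553147623238985650356207707545898204301670774732679880002056882092734206876366552027408294309144999927531831773969668262585371840678400000000, 0⟩,
    ⟨450898793663703129067778755763318416448465094042914337056514104291972000479939154971314937818862139728602005467166649757427413926255927936586762824960000000, 0⟩,
    ⟨-112724698415925782266944688940829604112116273510728584264128526072993000119984788742828734454715534932150501366791662439356853481563981984146690706240000000, 0⟩,
    ⟨-183429252556272087662059549638091029905653489708306111447655570328597984570243104896254793342606305726646686375873039996185594169777104612595842689395000000, 0⟩],
  [⟨-498915639037223063732900863519550610040766452322661118912765750284026754831335612417980790894997832348651909203275483347941343002322407077727527396245683000, 18701809081003475800008732850871693116880660862840044908260221838899972067488762374546124842676514390700196016882352853959373855864976055209412195635117000⟩,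
    ⟨0, 0⟩,
    ⟨1803337485196480870316428852721772520446252430434093525414660901364712113976141002711519989324565970505348341393017685659448410948859610521068039682951168000, 3723164149916683824436819741512537940272772570248766757049587480208720154773737395752492304422015358104717906374912126364565316143300422500520506554368000⟩,
    ⟨4254892230114574742347258828240449542362392534469716879525017771677490268629279397438773792229904983053441714537694280048072330552383442887976261696909900800, -80986163550241010956125120196363726536197018802416624630061598214670020692577731311401588559519175904464750506982726902576174354169765115742862327424179200⟩,
    ⟨-2759535925888350756665977222378465205691126303953155344043471698696789136183489751777652928352331481741185860054646938160717861766084019569811049336225676800, 78192047644518823187115755081407839156327467473249817777355926483950920323279383338080070358996055818181886546426015306245696851991446806983063001046003200⟩,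
    ⟨21665298274034893348093613495146442769772301970170391095054031299056028305145257679599152941259363941573119333430481694871955125603577076936484723006480213400, -466542655425375098547022054851873567847674527405387164818649940755956908852317810674903513924768683854448343422087778492249790102006838057634894523529376600⟩,
    ⟨-23229775285653480701723932399027229080967187746383482155460674837421718714440387943614552274607505184200206177027133145579263333324087202634543272576668422400, 486760221931367269873343631606168447908515368927752349734329599480331706750820264424354180428483609573921952913456195866048371303542250890731444214724567600⟩],
  [⟨-9620532434441911952979582152358989814385577806847564860030533971091277682513482319875363449844903256848968517264847756444678157373251974405859423685481015625, 224912019376152699592212819498679050649119533844641786322742150789424009041309596546312415192291119932919580087521959403217698114422420211661514350236796875⟩,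
    ⟨0, 0⟩,
    ⟨18498308322734644961071157237079692858538951605823481335158682572185433288556784042176312119058256752787794144618998057406586036267291494747649400266752000000, -669181330289143915881140708474520139074184220794905150201902069951680925689978770547478682296095225601868232473479379454416240782087820716924137611552000000⟩,
    ⟨-19835296491143911663898236780507805425134057345081846701275100176146992978410969913261342150676247477882606584440571148575928813111550875986363148211898000000, 585533664003000926395998119915205121689911193195542006426664311207720809978731424229043847009083322401634703414294457022614210684326843127308620410108000000⟩,
    ⟨-51280546530629015796520254227425065976357810533231429735246662081601899320146966492042775008591414807260641173812381673804868477377997103553207511313367000000, -3784282384019394876151913775007529397588500118986002967461219344657306716344023463998820418632779250336490953547940101868377028311667930582050157835698000000⟩,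
    ⟨-139306623702049223805758070464437220143683216677546841551267327556187133578914616862923057121416810191968716272765537213079706327094019246186076861289759328125, 4287596394557688703218910340138014289517307297495481143041679180618143118605420618712898080610039819505720188729002156836352495870388859105214127802141281250⟩,
    ⟨159794827428194149828750096565063791410615413695590938796247203720661324043539917999917353469795303848631090350309562931716229164810875915507749643404648000000, -1425965316742036740663302760181647286332679123827682642595309591744043073382345771381891443098814148116155809373672663020234879848296747258973929382160109375⟩,
    ⟨47527884862857839190689765636185464532434381987104905227014887957531382741851991350240898131967913762931418674194777562662212790226630585172876945545047843750, 781386953113733203489235964111798361139025439072925824467345363737742777790886366439936201216274362214240523164273571080843744272914376113763962266924031250⟩],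
  [⟨1845795415775879102772791017782514495402095361632568880714885517176707326248747150097740945351458341208039352740302015734102510381751363687332213486607412467400, -35475637327952360415880827379341953361981329843818508141377306439262734822605148944612786294511566968050108197693861765539021509409098578824020801327071227400⟩,
    ⟨0, 0⟩,
    ⟨-4296914635746044736082503066542439441991799488567774078936169349642832228974473121365049860656870957327085604802980886926942161284811064673625982420596438056960, 82362132020275268830939857723510070319756175386141506735148142351661237012770777367815288121610789534426182753958501130491587289559949470046905593438315560960⟩,
    ⟨3749971731874737840883774965714798988935273966464825675184374703223710015163050334011338363357523316669297246319512676917219506359397365592949297277860600663040, -71948952583594017338903844054662880878748356760856726229167030619725941819248184372086642623596379601084939098823648723937010928573000141685040111556611159040⟩,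
    ⟨-11151715618364959585398831524504119862153075461194522353071654387748083140815499129884760215877750964744317090525944174994655843914284727288327806951692486039040, 209766040939212552682148274012314107959743846562079534538981230019486093092615701467600058134692409561378622741176986025647116561502641967628592100541798935040⟩,
    ⟨27475328788292191712150844795964437900287657643315115180433797051738209178003604842680046906190228358006086281580218813399126789298105437922096664154016239994040, -527041289016681299878903838952804300596743086271787836121433705198206812748510942051058583849729118139375721952745130865485724612906389798472209263507051140040⟩,
    ⟨-17158235736186996108797718677629887340477083879187789755891542795564442016223859850049091734989817922051853545591035694878127519927346162333126699675035230049120, 331808926959674596011238954408097202586849402118833821889588774924319317430266580303252716189414698480867752815730041916460473715542451311079331177585301787120⟩,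
    ⟨-541963766087773565415416007142848771064765232303123341535494610303682317846214216577903662891249668459813220951625579181709636094481990451224913442841569522240, 12135633121301899254715530595992086941795796302702446522752722054996287816556835853074525099773361189928585768240469618231210522451595153560789241737288098240⟩,
    ⟨86072690762599566375845175935713840397920169751811966669485624811781042516128157964740777060008118153852874542939509829434753162704920329870804661347134042880, -1653970215233642627872522299111790319286076124179222356827087342227777218207637625543657918717938727165602112806160294454648978432519514780463481336939354880⟩],
  [⟨3403970960781049634556942447271374169745481349763956908535327905021990107468014936697646622786364963890007824856543690700173710220182814436845461932445631718750, 39196528263931463407561036003540517439779007291360052226141828593475554748657558032107700887645077934100996200223283464385260632087411452025889854847280390625⟩,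
    ⟨0, 0⟩,
    ⟨-35118603030704699429150958643312649907745214154637124760752718019924368034279114693470032928713681688113941457683886552557537079385124696578207807321959808000000, -614423742738577410002743374472011071906389416553264722224257804218010422951215975991716423599827457384095530349084649335955976470466299475741303436560352000000⟩,
    ⟨30735310307703265199418562161771644542798263728888323839452290386868331747690323488416794553510181842022946017110997615438586291061363890600029542997231882000000, 537620774896255233752400452663009687918090739484106631946225578690759120082313978992751870649849025211083589055449068168961479411658012041273640506990308000000⟩,
    ⟨-520209960631693165488534014533466272565419335456823689024355748386822483069841676004781706437867091412848338887952856901788038823547637749286729473712877057000000, -9851010978706275039207902173267074073211258810210083041262352930275905179016263789915542750207974707531984750261145365137315342220348086541077258504714158000000⟩,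
    ⟨225050051692668842197960109599025463417082027640954719270374238680923671236825113093287161959117117581980417790131293639518285460169322282803124294761009507703125, 3936752125105279674832030546787953752712715783208954924329448685033560922834890643048487749256316355368213647090180062786335118772196670762049503757102020968750⟩,
    ⟨116297171015294970438283565649288632979294219203620447652631810877072748902020412420862326131476203715293194768166167901022401307386837124278733252733814722515625, 2484250586807755667180303649676726843406296387787653728693177562172410004622944205380835010239169989511047493105962728888520670934530368088342331910814277484375⟩,
    ⟨183632592360910931850335375243146379449180788676996366100174349045729063077168327867523872965244092260941495251360570090519950455355125771434501964923763121515625, 3541705216335311142397529511926861905093173191822268547633242954030916326762325323319643044056747495199511874136763303132286250338015046730503162001635319109375⟩,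
    ⟨-22490641999236233717600108585123064816197665750245557340856443435426697066153113607510986633390695374510597179751388926972431797203842484992477146467861678500000, -434092667273759043820577047947910799773707132385594032102269329522823045153989125699995827115104979404485243558280225552338418356057524813028847794063924000000⟩,
    ⟨18709739360034243599332784787754492510331481569692243425647894863999994493291650261981977144487994942395464824797292778718410219637686345296341191895626915546875, 360002157310078311461397398628903238321300249554597910760643455495616718070337182833429625833179201096607924579931793585120956958384401755652881703949228046875⟩],
  [⟨-350578801946582906038337934006322113090496742101617228455616405779155206865769959839953725358069342879353207628117421884347408787137228212457761547229188439064, -37928963740234217099221513743656267032005140466112368062219491945868349928284542648618407971778008496603325703933676554671254941715247282729231899016581595664⟩,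
    ⟨0, 0⟩,
    ⟨12368204992585149207419878990899656342773006321356735337339566346559113711656159237351771799492857071142131171532473407413776974692385955137805762685585051402240, 310652516385223820386492671660041010688571418719506952741607307226999276068677002164344021915456417155691662433768526767402340874898816243138561909477486428160⟩,
    ⟨-10819297604076415080080771309292004507746726144062868924800495651215444572842118282563383981573269802796889090375976928227756014148953681651319069385682181570560, -271820951837070842838181087702535884352499991379568583648906393823624366560092376893801019176024365011230204629547460921477048265536464212746241670792800624640⟩,
    ⟨212971426225145636997342366503595645479893371438204178192869723917939726643062188690288441457209342508348717037428032580106018690175111098377865552181786508666880, 4285625056833638279181206070048849621613525252198783223268994484503533416967158558960078840462417651462780188647999354473960974399301043425284800034386655272960⟩,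
    ⟨-79229479009924609659618400238791669176701123133508566104763260128097324746494056632781776039253803808238949631999066087337460843377145111309974233059454577992160, -1990421054690872544488064862071805733523161209197934684509458537808927978795497862500255007604794485311028317605425101680592537578331184932843852234454871538240⟩,
    ⟨-58980134457843574815799015391508818729881271344056946931887956762845713993977815288918615459747476695986037263194393103385522469906447558543408992724607355077304, -843050388035896613833340721872020142508324305954223438934256698176881760081932985492481754390331093996290372768792983326599873396536196963847205589580774873264⟩,
    ⟨-77551400470510792077542553685712112697798855466844393408060120231604246969999028576606986284444366049080243649836352335973868893397330154915900350179320435015240, -1482300993861370957108867095977817761739502251002637194512407996403063118922597072490697076804233681975068852706918695043896959382892455455310117595820880208760⟩,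
    ⟨8950330598425318858365899594091717841652033301261727381221175960158601853017611864808223453196475851810825028422089209075363340999027953866334097575431850562304, 170655625520731067657758277704173681534233128509732050628866478658411493218844113727496237326241453050445665141794619102400677514575037142573563505274859903744⟩,
    ⟨-7349183200865728290891568428347033816694626728796340520160503493354451477429515766835973916450048476468560909521634474732039709377546297947433901782056833419080, -141409679373397950913614063136712591567674770309681485630431092776999961313555699700713867785369447658239723805283878249316342292021960956533508820434462611080⟩,
    ⟨126966201170222828850350481181147827537179086165720382528442378836209829879988625588208644865048441035424249067822929628066569704855110336629246388127881984, -1167200750040944167674908515933113162131117864471341788059453578650652719135125351965971584439220456719003660704567209976931741387006986767639038630153216⟩],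
  [⟨-6812374288471243017381186317359564719571302180238125877202969101739490400793644537467820339931060859831924365342266282641436890999927421378078435867087425000, -132525301855619790025146924526349745829438315824869770746085421017205430009843383554682961847441270259672138062437862791949090697541863414171449735918050000⟩,
    ⟨0, 0⟩,
    ⟨94970333375878398508018867119912975333691340381964529708812443475131100403401979648280414087961520976460639927675563803024201706540873240866392713967360000000, 1789279931961097879439597400696158135557464329970107689772008220830175613649212194804035426204264213068957889726050296493637320850390418567629487063040000000⟩,
    ⟨-83274061630381483461720449168016194118101366522038252612884140225958307247899866469503964835724968132324030451996136961433598976260429215680847697133760000000, -1565619940465960644509647725609138368612781288723844228550507193226403661943060670453530997928731186435338153510294009431932655744091616246675801180160000000⟩,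
    ⟨1611150707594975290475941795430226479290718251799024692236612346736311603556472854998085370312990373361561627963379045556679092678561260177135374401653504000000, 30943957868546047509548144405279837135850931223880967407527472567034324111165143061219458957095401833881373810005201213023623286745590652240740524586944000000⟩,
    ⟨-609493235830483902903755046688187072395790179524835325736121922250517570564367292555996061193550695050188826768156682406142612614929117549837797213523925000000, -11464321907809339049807811080046380397844261200130738820892720641471466993312969931747340264966970216743586635246695307905033654393956578342008852168560000000⟩,
    ⟨-416550245521709404802279040838243465036476683281634524075087732533798992571099294449322052525571905676850026060104554654529391533736878025309550888642994425000, -8239645449582766051696042520529339895382369066713918001222929770297648596875206192950701564615046592437160883835000453074284677432165211590191553065004550000⟩,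
    ⟨-606309969618768618751432402508252293728789545983521582740176777218011663814973498584034175663973040087206056753980571625512174820808104759885949986445696875000, -11669074241756325846039922138134937361649262238513141351034534430202591208438476080194598689505057859182798658429942077843414734218652042640446113194303125000⟩,
    ⟨129942166524773686939014852749176089911555094248270763054453802830085990278779181846425249365426033520314580358838772513658659829759247777260964361073016800000, 2499422799623397523746816613913386252137329666773413034410234463710126880491223942583082095962185821364488024112154501248431908282127074697429482737568800000⟩,
    ⟨-112392433143873473548324698564334767753912616075705746405953563286943889471726605491337817761442678610656064666749048003480412141475286127031366477306367875000, -2163370581463929416372317699399711712310721462871805942203019194945383489431163649250201648521054334321547656965861738005434241853394247874125087256767875000⟩,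
    ⟨65249555597186061267373149940957043276194050085323835929066370385623411628939304586187268464042162260005622044226412019269990503323107429814843904840800000, -501281043277708417777344758526364738954766850384812312981704738832691788573893043433308933054344454076434198849053532995105206833786813894655424339200000⟩,
    ⟨-12132249642530885715647517396506617259612483413608608246965802644217687431051975441545161249377463453398000977237071668298067966521471280784722853125000000, 2398103846675594134107013115002322822063119004214795253063104324905466493714602587912957055503935519360836405674491819351643668527201415714017637500000000⟩],
  [⟨1450813770252868977502567973919463745188552933592267819771424300565629784176043022222746453745716312790014816906092831818786253027216297322088232110004813000000, 15711922374072759946228760621985233638594943507246682842554255421710217151937806811356723813676560736135274847565387968212067844040168700720783725804928000000⟩,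
    ⟨0, 0⟩,
    ⟨-14795434380576274873074595324544776059734212587874188544438417344750176293352983289443289941554875814902230088390923145434714942160380260707443247818225152000000, -256300751509716035395807625349736487004773088098808083325688985604063656756769622837761463330931833821160565797157114860059294397040764604758295654105088000000⟩,
    ⟨12953268784336706816740380467657657509543733373335242455075420937503094717857075906796901501089821931261776032113237490138505640143873338476319461841534208000000, 224263157571001530971331672181019426129176452086457072909977862403555699662173419983041280414565354593515495072512475502551882597410669029163508697341952000000⟩,
    ⟨-221033774902524049469245592020085566038655239554737938750521211150867861821889760919886851927616846343732367223931526369802210794059782148421036326105635648000000, -4179237691226262181297837055264633440011372915130795520727485850327237013731556687143082834052216102726659563355056782216174812091553914509885440632328192000000⟩,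
    ⟨94839069215949104414231112178286857510499545885167676656045964254066216240479605785593599891741064884029423132967155262237870389637601298931003278104296653000000, 1642176983061764558820208818280879971912418194351835776074067807176036769512856929139211875892816173535775851753074053317235381385727008370917165807210432000000⟩,
    ⟨49820428242153060785245219013794241610848922222132214049245781595022885953082194684566662627672756774577182585493749924187854028547264483957698237523000144000000, 1072884546708863226958665500973977138984458727091046451435982643015933094862269266225311725304425898498087184593715182138546255461690693919090899361176832000000⟩,
    ⟨78466023674680986160426366354495272319448223177511444137241165331479854148097725285002000098839596642477332692822037069865130067015636629409740320326281392000000, 1513670132147785666714199846880516707252346606109744797028070990696642620485905816694507383106355900896885477835021423149012715132735828362239369244017808000000⟩,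
    ⟨-10447526825171977443300875810301840065715320926898335331102901119265047307349601565363913133970238771356808464428923896794193212056259541129114858986606592000000, -201704612323231847337968586685804593296110211555615705650393845927757348235750140886774601368370073023937416558482935776475074090470399149912871660143104000000⟩,
    ⟨8761439857349293718112302152825791151418495647308804278662829704102184341418203804580675768787079266279022757735217314565668755895613026226195673519127280000000, 168587858232001223171892665781815111838114279389399665005220614592209386332285682355508585905580650323048565622605828778591269500208930823268620822799280000000⟩,
    ⟨-628232495828186863877514318942859671300514446019873322927708600438045254200762730757186621410128756984250987657901204353615187649936285330222652904448000000, 1170080389719276770498202223190806156970121299542350632486346253359533447268190042791381861923170864312512983804292865467838630823828538071545009152000000⟩,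
    ⟨-300995438814796698643023060801510744077763500327654842549190622548687210312058624135273867768905853250266442170601976673067159051430082212346666000000000000, -24673107586768410816021706284550846196505490884392881760765482881904115608087894430738720935781852998982714248604017144496509322516450883067932000000000000⟩,
    ⟨-4488944737349071133818485877203670208817145551129022567500915610176358494047342245589607490600310458666538285764899509546663311238713397451633433771200000000, -28042009081853416868473915957709402813452380926285061177212310401224701191650636930728346828670329555633812532718277161362672056528318498743324784000000000⟩],
  [⟨1091093076150714840736823876305546962566364674339586600166893543908670131482186056282820389829415068976566686000806024769268299140730746833702163881670160375000, -6135595137968711068554611014513103550550302958110068425944142137446728170526866210822564851593964241022729385581796395774036131055164012885867614889809250000⟩,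
    ⟨0, 0⟩,
    ⟨-6313573624591815685901785307741337474368689299274749548450872700427590094286216974163553003771937184937120457801555085812858038322081121659793603197053184000000, -57679134110049608316963100400704873262157617903865848898980960290283939438242708056307411360307472020489536224597471089123824101378624974131007958798336000000⟩,
    ⟨5511501915744856420714407482360657473846341292352113210925680901150254856687393971915443819068622328148474731569342204632367530556184584902792323622945856000000, 50572057208490349365046344886600454345715645073893440444091395916897000899994763550425822425309826165812869526535722588836317235585507159736670407673344000000⟩,
    ⟨-73447028832217945911315283883521720490100226882959879551827942553375239888525325054393203087840168570766037768963331428259405185377204907097751935531003776000000, -1257429044905470680998472487806740059105471603525092235518217307031216646814723239326675027015442478073887502385725872906377190455295462624512601157077824000000⟩,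
    ⟨40379169450467646402003151773256078540138097085293075281015569738995813165693541008341141242487978352929908458971749074737416462966076928254945219560863061000000, 370148842941765670335041488049689018516054149389436476918608653408766887646218095090019142722397656645404686420136178697300720368891321257682882247538004000000⟩,
    ⟨9124558660817355639316978870549625623606983884460953991560118560876568535843752317916002182075500597521440349367020511200155933757916040595565942512218904625000, 439220163876251978280228908443995609748509041351198853074676435125111113459938849949165586296313196547276784668888353059056652362606309959381152397644757750000⟩,
    ⟨24034272918369133802545595670257426259011072257677195472699874210231292031552289925733618919027247873629695938708722112137998033891595350370068030450286332125000, 471157769124249778702855889917996029409679821668410238937825104763880818138801949835767963116719392109208667904735557988704741628704344739737587335671567875000⟩,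
    ⟨-2196031162235277637290480711267889796736520124185596651480362159195892288823477995672370994495831294272142736573222338341696329353485423368131229007240980000000, -42982542932813647754594627785600365740520675428050608415333380046467781437515604598956470075399735409885837058715342469207595135448873434919179176989388000000⟩,
    ⟨1782583771434233473893711708401514793950926089983339271375343000936322528267685577475149513952808641568653993052162449928364250737513135742720185000658313125000, 34285055541930498582596289193300770235334666745755744141490543198955446971664671357594361835080013762885531866994234246637861027567622102360912974584813125000⟩,
    ⟨-25863349791130420861072532420337910658833787409892843692706756816085864037216086061587573557597855443995038179029630039902875139283016176704214239315140000000, 564526729714869381020581527946366237013328895315701217015114459012860293587409256698706144538284620742467519628528742340286690838206997923599345889312000000⟩,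
    ⟨15883298323968865904966031534425067603193036704982205772499711710174945924249177946024638257219225208602414962068501408405809787499236946079781513909375000000, -218049791603615198293474669807709761021323913751729141980587340993506672930007631460330496912189812648985018572643227124287546799754211461055872362500000000⟩,
    ⟨37485318808953938098148846173739067746412309295077478809036510647293601152022818448450445895467692629165540736574645928461335377773508203279780532378920000000, -1089347358871014294168495520928128692899578052353741162677732876133040773738353191009994906587735266177099724026519782250841050287527789583040441422720000000⟩,
    ⟨17504601630351413677547927739471618278935633575418368148070292289120012097040571840527561051859322067566629390372959231184464409460894043821092989114042750000, -414701185625867015742704821234008379685551342786223170573137150082484102528960024439783834114795027219318109698929453018804893927905169330052487461221500000⟩]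
]

/-- The common denominator of the weights. -/
def rkWeightDenominator : ℕ := 72080481440583356959558431966974114457501421155862319334688597198447367692497218556862524479270351601772800

/-- The weights, multiplied by `rkWeightDenominator`. -/
def rkWeights : List (ℤ√2701) := [
  ⟨2339193802478775160659504041660054993203280049137255876742172077384525438303984405637123636180230892229568, 16386298416030988845549030717145671219976249419696336697731038797980088719695294271066605891893545455232⟩,
  ⟨0, 0⟩,
  ⟨0, 0⟩,
  ⟨0, 0⟩,
  ⟨-360426382059418269993682746798498256297382835863496977084907448922464375572720146708430046255137618699223040, -7911437383688306430426994444884024031578259963682252863321889499414217341149855232205836607388453772984320⟩,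
  ⟨0, 0⟩,
  ⟨183880673293036300667142123984960614954747610881478731653513125039606074887728591798583717724793934470294195, 4322157217360678420875549672909703936596821232726854192572647932636333169472290427281286715509998597544350⟩,
  ⟨213260349730898512823811406427717460264536694787917325409596377242107205751763359883530940800861113425001120, 4100656319432769191108125701760465338156682229276864617278348506284417849308702234311783018418863939710880⟩,
  ⟨-273936669154070721038552573490256418395623577458506265102291045093137887188054052623064373871337041538836480, -5564881654215610866551111557419630501575995911721473758106154155102071537032764972525256572271794769305600⟩,
  ⟨271747978250860571828259628050261663481587621590443725934943578363287442598737695530353228278729717078402720, 5432084450266641824687451570150431104878440673162138843873365849036100706909078921256355741144171445530720⟩,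
  ⟨-50990007264127058547467769398447738608209814024456416144697156148745525019647160903438196879105066582882304, 1107696746263180202558555424114143785416038390921719046926817319466001718850088064481531723229889030365184⟩,
  ⟨52506999104022529210225551021542508462686785911596870913517775112606674055779100058979595827452000631250000, -774562043372861481328223324260229759106722996372994340504809875986322136440595259520235896976651600000000⟩,
  ⟨7092145141237033309730837220913853873796829963594356630838855735759211143729672722038637246479795311273980, -188669460960684995634195973138431971867898750636030092853199579810157615836711824170606322720490256581680⟩,
  ⟨23480758749655902124452160542226763461612877377352774525839586393676891717048328156666658706114536146964301, -532370113427303370104235598114632650026146579256751597580767726229134472376900831670561942259431764417566⟩,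
  ⟨3125441846009781414980310364893608266545947940800936721592777398367129879827846236005239264238750467298740, -7060376074533484030470501834940922112934573837770384982089809678930430423026821509526462577994395317200⟩]

theorem checkFrom_rkMatrix : checkFrom rkMatrix rkWeights rkDenominator rkWeightDenominator 8 1
    ([⟨1, List.replicate 15 1⟩] :: List.replicate 9 []) = true := by
  decide +kernel

theorem rkMatrix_length : rkMatrix.length = 15 := by decide +kernel

theorem rkMatrix_row_length : ∀ i : Fin 15, (rkMatrix.getD i []).length = i := by decide +kernel

theorem rkDenominator_ne_zero : rkDenominator ≠ 0 := by decide +kernel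

theorem rkWeightDenominator_ne_zero : rkWeightDenominator ≠ 0 := by decide +kernel

end RungeKutta

open RungeKutta in
/-- There exists an explicit 15-stage Runge–Kutta method of order 10. -/
theorem exists_explicit_15_stage_RK_method_of_order_10 :
    ∃ (A : Matrix (Fin 15) (Fin 15) ℝ) (b c : Fin 15 → ℝ),
      (∀ i j : Fin 15, j ≥ i → A i j = 0) ∧
      (∀ i, ∑ j, A i j = c i) ∧
      (∀ t : RTree, t.order ≤ 10 →
        ∑ i, b i * Phi A t i = 1 / (t.factorial : ℝ)) := by
  have hD : (rkDenominator : ℝ) ≠ 0 := Nat.cast_ne_zero.2 rkDenominator_ne_zero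
  have hE : (rkWeightDenominator : ℝ) ≠ 0 := Nat.cast_ne_zero.2 rkWeightDenominator_ne_zero
  refine ⟨fun i j => embed ((rkMatrix.getD i []).getD j 0) / rkDenominator,
    fun i => embed (rkWeights.getD i 0) / rkWeightDenominator, _, fun i j hij => ?_,
    fun i => rfl, fun t ht => ?_⟩
  · have h : (rkMatrix.getD i []).length ≤ j := (rkMatrix_row_length i).trans_le hij
    beta_reduce
    rw [List.getD_eq_default _ _ h, map_zero, zero_div]
  · exact sum_eq_of_checkFrom rkMatrix_length (fun i j => (mul_div_cancel₀ _ hD).symm)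
      (fun i => (mul_div_cancel₀ _ hE).symm) rkDenominator_ne_zero rkWeightDenominator_ne_zero
      le_rfl (by simp) (covers_nil _ _ _) checkFrom_rkMatrix t (order_pos t) ht
end

section
/- Let (A,b,c) be an s-stage Runge–Kutta method with all weights b_j ≠ 0 that satisfies B(l), C(m) and D(n). Then its dual method (A*, b*, c*) satisfies B(l), C(n) and D(m). -/
/-- Subquadrature vectors: `q_{n,i} = Σ_j a_{ij} c_j^n − c_i^{n+1}/(n+1)`. -/
noncomputable def qvec {s : ℕ} (A : Matrix (Fin s) (Fin s) ℝ) (c : Fin s → ℝ) (n : ℕ) (i : Fin s) : ℝ :=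
  (∑ j, A i j * c j ^ n) - c i ^ (n + 1) / ((n : ℝ) + 1)

/-- `d_{n,j} = Σ_i b_i c_i^n a_{ij} − b_j (1 − c_j^{n+1})/(n+1)`. -/
noncomputable def dvec {s : ℕ} (A : Matrix (Fin s) (Fin s) ℝ) (b c : Fin s → ℝ) (n : ℕ) (j : Fin s) : ℝ :=
  (∑ i, b i * c i ^ n * A i j) - b j * (1 - c j ^ (n + 1)) / ((n : ℝ) + 1)

/-- Property `B(n)`. -/
def PropB {s : ℕ} (b c : Fin s → ℝ) (n : ℕ) : Prop :=
  ∀ k < n, ∑ j, b j * c j ^ k = 1 / ((k : ℝ) + 1)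

/-- Property `C(n)`. -/
def PropC {s : ℕ} (A : Matrix (Fin s) (Fin s) ℝ) (c : Fin s → ℝ) (n : ℕ) : Prop :=
  ∀ k < n, ∀ i, qvec A c k i = 0

/-- Property `D(n)`. -/
def PropD {s : ℕ} (A : Matrix (Fin s) (Fin s) ℝ) (b c : Fin s → ℝ) (n : ℕ) : Prop :=
  ∀ k < n, ∀ j, dvec A b c k j = 0

/-- Dual coefficient matrix: `a*_{ij} = b_{s+1-j} a_{s+1-j, s+1-i} / b_{s+1-i}`. -/
noncomputable def dualA {s : ℕ} (A : Matrix (Fin s) (Fin s) ℝ) (b : Fin s → ℝ) :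
    Matrix (Fin s) (Fin s) ℝ :=
  fun i j => b j.rev * A j.rev i.rev / b i.rev

/-- Dual weights: `b*_j = b_{s+1-j}`. -/
def dualb {s : ℕ} (b : Fin s → ℝ) : Fin s → ℝ := fun j => b j.rev

/-- Dual nodes: `c*_i = 1 - c_{s+1-i}`. -/
noncomputable def dualc {s : ℕ} (c : Fin s → ℝ) : Fin s → ℝ := fun i => 1 - c i.rev

theorem one_sub_pow_eq_sum (x : ℝ) (k : ℕ) :
    (1 - x) ^ k = ∑ i ∈ Finset.range (k + 1), ((-1) ^ i * (k.choose i : ℝ)) * x ^ i := by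
  rw [sub_eq_neg_add, add_pow]
  refine Finset.sum_congr rfl fun i _ => ?_
  rw [neg_pow, one_pow]
  ring

/-- A quadrature rule on `[u, v]` exact for all monomials of degree `< n` is exact for `(1 - x) ^ k`
with `k < n`. -/
theorem sum_mul_one_sub_pow_of_moments {ι : Type*} [Fintype ι] {w c : ι → ℝ} {u v : ℝ} {n : ℕ}
    (h : ∀ k < n, ∑ j, w j * c j ^ k = (v ^ (k + 1) - u ^ (k + 1)) / ((k : ℝ) + 1))
    {k : ℕ} (hk : k < n) :
    ∑ j, w j * (1 - c j) ^ k = ((1 - u) ^ (k + 1) - (1 - v) ^ (k + 1)) / ((k : ℝ) + 1) := by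
  have integral_eq : ∫ x in u..v, (1 - x) ^ k
      = ((1 - u) ^ (k + 1) - (1 - v) ^ (k + 1)) / ((k : ℝ) + 1) := by
    rw [intervalIntegral.integral_comp_sub_left (fun x : ℝ => x ^ k) 1, integral_pow]
  rw [← integral_eq]
  simp_rw [one_sub_pow_eq_sum, Finset.mul_sum]
  rw [Finset.sum_comm, intervalIntegral.integral_finsetSum
    fun i _ => (by fun_prop : Continuous _).intervalIntegrable _ _]
  refine Finset.sum_congr rfl fun i hi => ?_
  rw [intervalIntegral.integral_const_mul, integral_pow,
    ← h i (by have := Finset.mem_range.mp hi; omega), Finset.mul_sum]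
  exact Finset.sum_congr rfl fun j _ => by ring

theorem PropB.dual {s : ℕ} {b c : Fin s → ℝ} {l : ℕ} (hB : PropB b c l) :
    PropB (dualb b) (dualc c) l := by
  intro k hk
  have key := sum_mul_one_sub_pow_of_moments (w := b) (c := c) (u := 0) (v := 1) (n := l)
    (fun i hi => by simpa using hB i hi) hk
  simp only [dualb, dualc]
  rw [Fin.rev_bijective.sum_comp fun j => b j * (1 - c j) ^ k]
  simpa using key

theorem PropD.dual {s : ℕ} {A : Matrix (Fin s) (Fin s) ℝ} {b c : Fin s → ℝ} {n : ℕ}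
    (hb : ∀ j, b j ≠ 0) (hD : PropD A b c n) : PropC (dualA A b) (dualc c) n := by
  intro k hk i
  have key := sum_mul_one_sub_pow_of_moments (w := fun j => b j * A j i.rev / b i.rev) (c := c)
    (u := c i.rev) (v := 1) (n := n) (fun r hr => by
      have hd := sub_eq_zero.mp (hD r hr i.rev)
      rw [one_pow, eq_div_iff (by positivity), ← mul_right_inj' (hb i.rev)]
      rw [eq_div_iff (by positivity)] at hd
      rw [← hd, ← mul_assoc, Finset.mul_sum]
      congr 1
      refine Finset.sum_congr rfl fun j _ => ?_
      field_simp [hb i.rev]) hk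
  simp only [qvec, dualA, dualc]
  rw [Fin.rev_bijective.sum_comp fun j => b j * A j i.rev / b i.rev * (1 - c j) ^ k, key]
  simp

theorem PropC.dual {s : ℕ} {A : Matrix (Fin s) (Fin s) ℝ} {b c : Fin s → ℝ} {m : ℕ}
    (hb : ∀ j, b j ≠ 0) (hC : PropC A c m) : PropD (dualA A b) (dualb b) (dualc c) m := by
  intro k hk j
  have key := sum_mul_one_sub_pow_of_moments (w := A j.rev) (c := c) (u := 0) (v := c j.rev)
    (n := m) (fun r hr => by simpa using sub_eq_zero.mp (hC r hr j.rev)) hk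
  simp only [dvec, dualA, dualb, dualc]
  rw [Fin.rev_bijective.sum_comp fun i => b i * (1 - c i) ^ k * (b j.rev * A j.rev i / b i),
    sub_eq_zero, mul_div_assoc]
  simp only [sub_zero, one_pow] at key
  rw [← key, Finset.mul_sum]
  refine Finset.sum_congr rfl fun i _ => ?_
  field_simp [hb i]


/-- If a method with nonzero weights satisfies B(l), C(m) and D(n),
then its dual satisfies B(l), C(n) and D(m). -/
theorem dual_BCD {s : ℕ} (A : Matrix (Fin s) (Fin s) ℝ) (b c : Fin s → ℝ)
    (hb : ∀ j, b j ≠ 0) (l m n : ℕ)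
    (hB : PropB b c l) (hC : PropC A c m) (hD : PropD A b c n) :
    PropB (dualb b) (dualc c) l ∧ PropC (dualA A b) (dualc c) n ∧
      PropD (dualA A b) (dualb b) (dualc c) m :=
  ⟨hB.dual, hD.dual hb, hC.dual hb⟩
end

section
/- Let n ≥ 1, let 𝟙 ∈ ℝ^n be the all-ones vector, let b ∈ ℝ^n, and let Q and D be linear subspaces of ℝ^n (with the standard dot product) such that Q is the orthogonal complement of D + span(b) and D is the orthogonal complement of Q + span(𝟙). If Σ_i b_i ≠ 0, then 𝟙 ∉ Q, b ∉ D, and dim Q + dim D = n − 1. If Σ_i b_i = 0, then 𝟙 ∈ Q, b ∈ D, and dim Q + dim D = n. -/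
/-- A subspace and its orthogonal complement for the dot product have complementary dimensions. -/
theorem finrank_add_finrank_of_mem_iff_dotProduct_eq_zero {K ι : Type*} [Field K] [Fintype ι]
    {U W : Submodule K (ι → K)} (h : ∀ v, v ∈ U ↔ ∀ w ∈ W, w ⬝ᵥ v = 0) :
    Module.finrank K U + Module.finrank K W = Fintype.card ι := by
  classical
  have hB : (Matrix.toBilin' (1 : Matrix ι ι K)).Nondegenerate :=
    LinearMap.BilinForm.nondegenerate_toBilin'_of_det_ne_zero' _ (by simp)
  have hU : U = (Matrix.toBilin' (1 : Matrix ι ι K)).orthogonal W := by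
    ext v
    simp [h, LinearMap.BilinForm.mem_orthogonal_iff, Matrix.toBilin'_apply']
  rw [hU, LinearMap.BilinForm.finrank_orthogonal hB, Module.finrank_fintype_fun_eq_card]
  exact Nat.sub_add_cancel ((Submodule.finrank_le W).trans_eq (by simp))

/-- The node-cluster theorem: with `Q` the orthogonal complement of `D + span(b)` and
`D` the orthogonal complement of `Q + span(𝟙)` (with respect to the standard dot
product on `ℝⁿ`), either the cluster is a quadrature one (`Σ bᵢ ≠ 0`), and then
`𝟙 ∉ Q`, `b ∉ D`, `dim Q + dim D = n − 1`; or `Σ bᵢ = 0`, and then `𝟙 ∈ Q`,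
`b ∈ D`, `dim Q + dim D = n`. -/
theorem node_cluster_dims (n : ℕ) (hn : 1 ≤ n) (b : Fin n → ℝ)
    (Q D : Submodule ℝ (Fin n → ℝ))
    (hQ : ∀ v : Fin n → ℝ, v ∈ Q ↔
      ((∑ i, b i * v i) = 0 ∧ ∀ d ∈ D, (∑ i, d i * v i) = 0))
    (hD : ∀ v : Fin n → ℝ, v ∈ D ↔
      ((∑ i, v i) = 0 ∧ ∀ q ∈ Q, (∑ i, v i * q i) = 0)) :
    ((∑ i, b i) ≠ 0 →
      (fun _ => (1 : ℝ)) ∉ Q ∧ b ∉ D ∧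
        Module.finrank ℝ Q + Module.finrank ℝ D = n - 1) ∧
    ((∑ i, b i) = 0 →
      (fun _ => (1 : ℝ)) ∈ Q ∧ b ∈ D ∧
        Module.finrank ℝ Q + Module.finrank ℝ D = n) := by
  have hQb : ∀ q ∈ Q, ∑ i, b i * q i = 0 := fun q hq => ((hQ q).1 hq).1
  have hD1 : ∀ d ∈ D, ∑ i, d i = 0 := fun d hd => ((hD d).1 hd).1
  refine ⟨fun hb => ?_, fun hb => ?_⟩
  · have hbD : b ∉ D := fun h => hb (hD1 b h)
    refine ⟨fun h => hb (by simpa using hQb _ h), hbD, ?_⟩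
    have hdim : Module.finrank ℝ Q + Module.finrank ℝ ↥(D ⊔ Submodule.span ℝ {b}) =
        Fintype.card (Fin n) := by
      refine finrank_add_finrank_of_mem_iff_dotProduct_eq_zero fun v => ?_
      rw [hQ]
      constructor
      · rintro ⟨hbv, hDv⟩ w hw
        obtain ⟨d, hd, y, hy, rfl⟩ := Submodule.mem_sup.1 hw
        obtain ⟨c, rfl⟩ := Submodule.mem_span_singleton.1 hy
        rw [add_dotProduct, smul_dotProduct, show d ⬝ᵥ v = 0 from hDv d hd,
          show b ⬝ᵥ v = 0 from hbv, smul_zero, add_zero]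
      · intro h
        exact ⟨h b (Submodule.mem_sup_right (Submodule.mem_span_singleton_self b)),
          fun d hd => h d (Submodule.mem_sup_left hd)⟩
    rw [Submodule.finrank_sup_span_singleton hbD, Fintype.card_fin] at hdim
    lia
  · have hbD : b ∈ D := (hD b).2 ⟨hb, hQb⟩
    refine ⟨(hQ _).2 ⟨by simpa using hb, fun d hd => by simpa using hD1 d hd⟩, hbD, ?_⟩
    have hdim : Module.finrank ℝ Q + Module.finrank ℝ D = Fintype.card (Fin n) :=
      finrank_add_finrank_of_mem_iff_dotProduct_eq_zero fun v =>
        (hQ v).trans ⟨fun h => h.2, fun h => ⟨h b hbD, h⟩⟩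
    rwa [Fintype.card_fin] at hdim
end

section
/- Let (A,b,c) be an explicit s-stage Runge–Kutta method (a_{ij} = 0 whenever j ≥ i) with s ≥ 2, satisfying d_0 = 0 (i.e. Σ_i b_i a_{ij} = b_j (1 − c_j) for every j) and b_s ≠ 0. Then a_{s,s−1} = b_{s−1}(1 − c_{s−1})/b_s and d_{1,s−1} = b_{s−1}(1 − c_{s−1})²/2; consequently, if moreover b_{s−1} ≠ 0 and c_{s−1} ≠ 1, then d_{1,s−1} ≠ 0. -/
/-- For an explicit method with `d₀ = 0` and nonzero last weight:
`a_{s,s−1} = b_{s−1}(1−c_{s−1})/b_s`, `d_{1,s−1} = b_{s−1}(1−c_{s−1})²/2`, and hence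
if `b_{s−1} ≠ 0` and `c_{s−1} ≠ 1` then `d_{1,s−1} ≠ 0`. -/
theorem penultimate_stage_coorder {s : ℕ}
    (A : Matrix (Fin (s + 2)) (Fin (s + 2)) ℝ) (b c : Fin (s + 2) → ℝ)
    (hexp : ∀ i j : Fin (s + 2), j ≥ i → A i j = 0)
    (hd0 : ∀ j, (∑ i, b i * A i j) = b j * (1 - c j))
    (hb : b (Fin.last (s + 1)) ≠ 0) :
    A (Fin.last (s + 1)) (Fin.castSucc (Fin.last s)) =
        b (Fin.castSucc (Fin.last s)) * (1 - c (Fin.castSucc (Fin.last s))) /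
          b (Fin.last (s + 1)) ∧
      dvec A b c 1 (Fin.castSucc (Fin.last s)) =
        b (Fin.castSucc (Fin.last s)) * (1 - c (Fin.castSucc (Fin.last s))) ^ 2 / 2 ∧
      (b (Fin.castSucc (Fin.last s)) ≠ 0 → c (Fin.castSucc (Fin.last s)) ≠ 1 →
        dvec A b c 1 (Fin.castSucc (Fin.last s)) ≠ 0) := by
  have sum_eq (f : Fin (s + 2) → ℝ) :
      ∑ i, f i * A i (Fin.castSucc (Fin.last s)) =
        f (Fin.last (s + 1)) * A (Fin.last (s + 1)) (Fin.castSucc (Fin.last s)) := by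
    rw [Fin.sum_univ_castSucc, Finset.sum_eq_zero, zero_add]
    intro i _
    rw [hexp _ _ (Fin.castSucc_le_castSucc_iff.mpr (Fin.le_last i)), mul_zero]
  have c_last : c (Fin.last (s + 1)) = 1 := by
    have h := hd0 (Fin.last (s + 1))
    rw [Finset.sum_eq_zero fun i _ => by rw [hexp i _ (Fin.le_last i), mul_zero]] at h
    linarith [(mul_eq_zero.mp h.symm).resolve_left hb]
  have weight_mul := (sum_eq b).symm.trans (hd0 _)
  have dvec_one : dvec A b c 1 (Fin.castSucc (Fin.last s)) =
      b (Fin.castSucc (Fin.last s)) * (1 - c (Fin.castSucc (Fin.last s))) ^ 2 / 2 := by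
    rw [dvec, sum_eq fun i => b i * c i ^ 1, c_last, one_pow, mul_one, weight_mul]
    push_cast
    ring
  refine ⟨by rw [eq_div_iff hb, mul_comm, weight_mul], dvec_one, fun hb' hc => ?_⟩
  rw [dvec_one]
  exact div_ne_zero (mul_ne_zero hb' (pow_ne_zero 2 (sub_ne_zero.mpr hc.symm))) two_ne_zero
end

section
/- Let (A,b,c) be an s-stage Runge–Kutta method and let m, n ≥ 0. If Σ_i b_i c_i^n q_{m,i} = 0, Σ_j b_j c_j^m = 1/(m+1), and Σ_j b_j c_j^{m+n+1} = 1/(m+n+2), then Σ_j d_{n,j} c_j^m = 0. -/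
/-- If `Σ_i b_i c_i^n q_{m,i} = 0`, `Σ_j b_j c_j^m = 1/(m+1)` and
`Σ_j b_j c_j^{m+n+1} = 1/(m+n+2)`, then `Σ_j d_{n,j} c_j^m = 0`. -/
theorem dn_dot_cm_eq_zero {s : ℕ} (A : Matrix (Fin s) (Fin s) ℝ)
    (b c : Fin s → ℝ) (m n : ℕ)
    (h1 : (∑ i, b i * c i ^ n * qvec A c m i) = 0)
    (h2 : (∑ j, b j * c j ^ m) = 1 / ((m : ℝ) + 1))
    (h3 : (∑ j, b j * c j ^ (m + n + 1)) = 1 / ((m : ℝ) + (n : ℝ) + 2)) :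
    (∑ j, dvec A b c n j * c j ^ m) = 0 := by
  have hq : (∑ i, b i * c i ^ n * qvec A c m i)
      = (∑ i, ∑ j, b i * c i ^ n * A i j * c j ^ m)
        - (∑ i, b i * c i ^ (m + n + 1)) / ((m : ℝ) + 1) := by
    rw [Finset.sum_div, ← Finset.sum_sub_distrib]
    refine Finset.sum_congr rfl fun i _ => ?_
    simp only [qvec, mul_sub, Finset.mul_sum, mul_assoc]
    ring
  have hd : (∑ j, dvec A b c n j * c j ^ m)
      = (∑ i, ∑ j, b i * c i ^ n * A i j * c j ^ m)
        - ((∑ j, b j * c j ^ m) - ∑ j, b j * c j ^ (m + n + 1)) / ((n : ℝ) + 1) := by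
    rw [Finset.sum_comm, ← Finset.sum_sub_distrib, Finset.sum_div, ← Finset.sum_sub_distrib]
    refine Finset.sum_congr rfl fun j _ => ?_
    simp only [dvec, sub_mul, Finset.sum_mul]
    ring
  have hT : (∑ i, ∑ j, b i * c i ^ n * A i j * c j ^ m)
      = 1 / ((m : ℝ) + (n : ℝ) + 2) / ((m : ℝ) + 1) := by
    rw [← h3]
    linarith
  rw [hd, hT, h2, h3]
  have hm : (m : ℝ) + 1 ≠ 0 := by positivity
  have hn : (n : ℝ) + 1 ≠ 0 := by positivity
  have hmn : (m : ℝ) + (n : ℝ) + 2 ≠ 0 := by positivity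
  field_simp
  ring
end

section
/- Let (A,b,c) be an s-stage Runge–Kutta method. For all rooted trees t and t′, Σ_j D_j(t) Φ_j(t′) = bΦ(t ∗ t′) + (1/t!)·Σ_i b_i c_i^{|t|} Φ_i(t′) − (1/t!)·bΦ(t′), where t ∗ t′ denotes the beta-product of t and t′, i.e. the rooted tree obtained from t by attaching t′ as one additional child subtree of the root of t. -/
/-- `D_j(t) = Σ_i b_i Φ_i(t) a_{ij} − b_j (1 − c_j^{|t|})/t!`. -/
noncomputable def Dvec {s : ℕ} (A : Matrix (Fin s) (Fin s) ℝ) (b c : Fin s → ℝ) (t : RTree)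
    (j : Fin s) : ℝ :=
  (∑ i, b i * Phi A t i * A i j) - b j * (1 - c j ^ t.order) / (t.factorial : ℝ)

/-- The beta-product `t ∗ t′`: attach `t′` as one additional child subtree of the
root of `t`. -/
def RTree.beta : RTree → RTree → RTree
  | .node ts, t' => .node (ts ++ [t'])

theorem Phi_node {s : ℕ} (A : Matrix (Fin s) (Fin s) ℝ) (ts : List RTree) (i : Fin s) :
    Phi A (.node ts) i = (ts.map fun x => A.mulVec (Phi A x) i).prod := by
  simp only [Phi]
  rw [List.attach_map_val (f := fun x => A.mulVec (Phi A x) i)]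

theorem Phi_beta {s : ℕ} (A : Matrix (Fin s) (Fin s) ℝ) (t t' : RTree) (i : Fin s) :
    Phi A (t.beta t') i = Phi A t i * A.mulVec (Phi A t') i := by
  cases t
  simp [RTree.beta, Phi_node]

/-- `Σ_j D_j(t) Φ_j(t′) = bΦ(t ∗ t′) + (1/t!)·Σ_i b_i c_i^{|t|} Φ_i(t′) − (1/t!)·bΦ(t′)`. -/
theorem D_dot_Phi {s : ℕ} (A : Matrix (Fin s) (Fin s) ℝ) (b c : Fin s → ℝ) :
    ∀ t t' : RTree,
      (∑ j, Dvec A b c t j * Phi A t' j) =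
        (∑ i, b i * Phi A (t.beta t') i)
          + (1 / (t.factorial : ℝ)) * ∑ i, b i * c i ^ t.order * Phi A t' i
          - (1 / (t.factorial : ℝ)) * ∑ i, b i * Phi A t' i := by
  intro t t'
  have hA : ∑ j, (∑ i, b i * Phi A t i * A i j) * Phi A t' j =
      ∑ i, b i * Phi A (t.beta t') i := by
    simp only [Phi_beta, Matrix.mulVec, dotProduct, Finset.sum_mul, Finset.mul_sum]
    rw [Finset.sum_comm]
    exact Finset.sum_congr rfl fun i _ => Finset.sum_congr rfl fun j _ => by ring
  simp only [Dvec, sub_mul, Finset.sum_sub_distrib, hA]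
  rw [add_sub_assoc, sub_eq_add_neg, ← mul_sub, ← Finset.sum_sub_distrib, Finset.mul_sum,
    ← Finset.sum_neg_distrib]
  congr 1
  exact Finset.sum_congr rfl fun i _ => by ring
end
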